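/- Suppose r, s > max(p, q), both r and s are coprime to pq (and ≥ 3), and r ≡ −s (mod pq). Then the sets of coefficients are negatives of one another: 𝒜(p,q,r) = −𝒜(p,q,s) = { −a : a ∈ 𝒜(p,q,s) }. -/

import Mathlib

open Polynomial
open scoped Classical

/-- The defining identity of the ternary inclusion-exclusion polynomial `Q_{p,q,r}`:
`Q·(z^{qr}-1)(z^{rp}-1)(z^{pq}-1)(z-1) = (z^{pqr}-1)(z^r-1)(z^q-1)(z^p-1)`. -/
def ternaryId (p q r : ℕ) (Q : Polynomial ℤ) : Prop :=
  Q * (((X : Polynomial ℤ) ^ (q * r) - 1) * ((X : Polynomial ℤ) ^ (r * p) - 1) *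
      ((X : Polynomial ℤ) ^ (p * q) - 1) * ((X : Polynomial ℤ) - 1)) =
    ((X : Polynomial ℤ) ^ (p * q * r) - 1) * ((X : Polynomial ℤ) ^ r - 1) *
      ((X : Polynomial ℤ) ^ q - 1) * ((X : Polynomial ℤ) ^ p - 1)

/-- The coefficient `a_m` of `z^m` in `Q`, indexed by `m : ℤ`, with the convention
that `a_m = 0` for `m < 0` (and automatically `a_m = 0` for `m` beyond the degree). -/
def aCoeff (Q : Polynomial ℤ) (m : ℤ) : ℤ :=
  if 0 ≤ m then Q.coeff m.toNat else 0

/-- The characteristic function `χ` of integers representable as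
`i·qr + j·rp + k·pq` with integers `i, j, k ≥ 0`. -/
noncomputable def chi (p q r : ℕ) (n : ℤ) : ℤ :=
  if ∃ i j k : ℕ, n = (i * (q * r) + j * (r * p) + k * (p * q) : ℕ) then 1 else 0

/-- The coefficient of `z^i` in `(1 - z)(1 - z^{pq}) / ((1 - z^p)(1 - z^q))`, expressed through
natural numbers `μ`, `ν` with `p * μ + q * ν = p * q + 1`. -/
def binaryCoeff (p q μ ν i : ℕ) : ℤ :=
  if i < p * q then
    (if i * μ % q < μ then 1 else 0) + (if i * ν % p < ν then 1 else 0) - 1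
  else 0

/-- The coefficient of `z^m` in `(1 - z^p)(1 - z^q) / ((1 - z)(1 - z^{pq}))`, extended to all
integers by periodicity modulo `p * q`. -/
def periodicCoeff (p q : ℕ) (m : ℤ) : ℤ :=
  (if m % (p * q : ℕ) < p then 1 else 0) -
    (if (q : ℤ) ≤ m % (p * q : ℕ) ∧ m % (p * q : ℕ) < p + q then 1 else 0)

/-- The first `k` terms of the cyclic convolution which computes the coefficients of
`Q_{p,q,r}`. -/
def truncConv (p q μ ν : ℕ) (r t : ℤ) (k : ℕ) : ℤ :=
  ∑ i ∈ Finset.range k, binaryCoeff p q μ ν i * periodicCoeff p q (t - r * i)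

lemma exists_mul_add_mul_eq {p q : ℕ} (hp : 3 ≤ p) (hq : 3 ≤ q) (hpq : p.Coprime q) :
    ∃ μ ν : ℕ, μ ≤ q ∧ ν ≤ p ∧ p * μ + q * ν = p * q + 1 := by
  obtain ⟨μ, hμ, h⟩ := Nat.exists_mul_mod_eq_one_of_coprime hpq (by omega)
  have h1 := Nat.div_add_mod (p * μ) q
  have hw : p * μ / q ≤ p := by
    rw [Nat.div_le_iff_le_mul_add_pred (by omega)]
    nlinarith
  refine ⟨μ, p - p * μ / q, hμ.le, Nat.sub_le _ _, ?_⟩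
  obtain ⟨w, hw'⟩ := Nat.exists_eq_add_of_le hw
  have h2 : p - p * μ / q = w := by omega
  rw [h2]
  have : q * p = q * (p * μ / q) + q * w := by rw [← mul_add, ← hw']
  rw [mul_comm p q]
  omega

lemma coord_eq_or {p q μ ν i : ℕ} (hp : 0 < p) (hq : 0 < q) (h : p * μ + q * ν = p * q + 1)
    (hi : i < p * q) :
    p * (i * μ % q) + q * (i * ν % p) = i ∨ p * (i * μ % q) + q * (i * ν % p) = i + p * q := by
  have h1 := Nat.div_add_mod (i * μ) q
  have h2 := Nat.div_add_mod (i * ν) p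
  have hx := Nat.mod_lt (i * μ) hq
  have hy := Nat.mod_lt (i * ν) hp
  set x := i * μ % q
  set y := i * ν % p
  set a := i * μ / q
  set b := i * ν / p
  zify at *
  have key : (p * x + q * y : ℤ) = i + p * q * (i - a - b) := by
    linear_combination (i : ℤ) * h + (p : ℤ) * h1 + (q : ℤ) * h2
  have hpx : (p * x : ℤ) + p ≤ p * q := by nlinarith
  have hqy : (q * y : ℤ) + q ≤ p * q := by nlinarith
  have hpx0 : (0 : ℤ) ≤ p * x := by positivity
  have hqy0 : (0 : ℤ) ≤ q * y := by positivity
  generalize (i - a - b : ℤ) = d at key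
  have hd0 : -1 < d := by
    by_contra hd
    have : (p * q : ℤ) * d ≤ p * q * (-1) := by
      apply mul_le_mul_of_nonneg_left (by omega) (by positivity)
    omega
  have hd1 : d < 2 := by
    by_contra hd
    have : (p * q : ℤ) * 2 ≤ p * q * d := by
      apply mul_le_mul_of_nonneg_left (by omega) (by positivity)
    omega
  obtain rfl | rfl : d = 0 ∨ d = 1 := by omega
  · left; linarith
  · right; linarith

lemma binaryCoeff_cases {p q μ ν : ℕ} (hp : 0 < p) (hq : 0 < q)
    (h : p * μ + q * ν = p * q + 1) (i : ℕ) :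
    (binaryCoeff p q μ ν i = 1 ∧ i * μ % q < μ ∧ i * ν % p < ν ∧
      p * (i * μ % q) + q * (i * ν % p) = i) ∨
    (binaryCoeff p q μ ν i = -1 ∧ μ ≤ i * μ % q ∧ ν ≤ i * ν % p ∧
      p * (i * μ % q) + q * (i * ν % p) = i + p * q) ∨
    binaryCoeff p q μ ν i = 0 := by
  unfold binaryCoeff
  by_cases hi : i < p * q
  · have hc := coord_eq_or hp hq h hi
    rw [if_pos hi]
    by_cases hx : i * μ % q < μ <;> by_cases hy : i * ν % p < ν
    · left
      have : p * (i * μ % q) + p ≤ p * μ := by nlinarith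
      have : q * (i * ν % p) + q ≤ q * ν := by nlinarith
      exact ⟨by simp [hx, hy], hx, hy, by omega⟩
    · simp [hx, hy]
    · simp [hx, hy]
    · right; left
      have : p * μ ≤ p * (i * μ % q) := Nat.mul_le_mul_left _ (by omega)
      have : q * ν ≤ q * (i * ν % p) := Nat.mul_le_mul_left _ (by omega)
      simp only [hx, hy, if_false]
      omega
  · simp [hi]

lemma binaryCoeff_succ {p q μ ν : ℕ} (hp : 0 < p) (hq : 0 < q) (hμ : μ ≤ q) (hν : ν ≤ p)
    (h : p * μ + q * ν = p * q + 1) (i : ℕ) (hi : binaryCoeff p q μ ν i ≠ 0) :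
    binaryCoeff p q μ ν (i + 1) ≠ binaryCoeff p q μ ν i := by
  intro he
  have hx : (i + 1) * μ % q = (i * μ % q + μ) % q := by rw [add_mul, one_mul]; simp
  have hy : (i + 1) * ν % p = (i * ν % p + ν) % p := by rw [add_mul, one_mul]; simp
  have hxl := Nat.mod_lt (i * μ) hq
  have hyl := Nat.mod_lt (i * ν) hp
  have hx2 : (i * μ % q + μ < q ∧ (i + 1) * μ % q = i * μ % q + μ) ∨
      (i + 1) * μ % q + q = i * μ % q + μ := by
    rw [hx]
    by_cases hlt : i * μ % q + μ < q
    · exact .inl ⟨hlt, Nat.mod_eq_of_lt hlt⟩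
    · right
      rw [Nat.mod_eq_sub_mod (by omega), Nat.mod_eq_of_lt (by omega)]
      omega
  have hy2 : (i * ν % p + ν < p ∧ (i + 1) * ν % p = i * ν % p + ν) ∨
      (i + 1) * ν % p + p = i * ν % p + ν := by
    rw [hy]
    by_cases hlt : i * ν % p + ν < p
    · exact .inl ⟨hlt, Nat.mod_eq_of_lt hlt⟩
    · right
      rw [Nat.mod_eq_sub_mod (by omega), Nat.mod_eq_of_lt (by omega)]
      omega
  have hpq := mul_comm p q
  have hpos := Nat.mul_pos hp hq
  have c1 := binaryCoeff_cases hp hq h i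
  have c2 := binaryCoeff_cases hp hq h (i + 1)
  rw [he] at c2
  clear hx hy he
  generalize i * μ % q = x at *
  generalize i * ν % p = y at *
  generalize (i + 1) * μ % q = x' at *
  generalize (i + 1) * ν % p = y' at *
  rcases c1 with ⟨h1, hx1, hy1, e1⟩ | ⟨h1, hx1, hy1, e1⟩ | h1
  · have ex : x' + q = x + μ := by omega
    have ey : y' + p = y + ν := by omega
    have e3 : p * x' + p * q = p * x + p * μ := by rw [← mul_add, ← mul_add, ex]
    have e4 : q * y' + q * p = q * y + q * ν := by rw [← mul_add, ← mul_add, ey]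
    omega
  · have ex : x' = x + μ := by omega
    have ey : y' = y + ν := by omega
    have e3 : p * x' = p * x + p * μ := by rw [← mul_add, ex]
    have e4 : q * y' = q * y + q * ν := by rw [← mul_add, ey]
    omega
  · exact hi h1

lemma coord_of_lt {p q μ ν x y : ℕ} (h : p * μ + q * ν = p * q + 1) (hx : x < q) (hy : y < p) :
    (p * x + q * y) * μ % q = x ∧ (p * x + q * y) * ν % p = y := by
  constructor
  · have : (p * x + q * y) * μ + q * (ν * x) = x + q * (p * x + y * μ) := by
      linear_combination x * h
    have := congrArg (· % q) this
    simpa [Nat.mod_eq_of_lt hx] using this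
  · have : (p * x + q * y) * ν + p * (μ * y) = y + p * (q * y + x * ν) := by
      linear_combination y * h
    have := congrArg (· % p) this
    simpa [Nat.mod_eq_of_lt hy] using this

lemma sum_binaryCoeff_mul_pow {R : Type*} [CommRing R] {p q μ ν : ℕ} (hp : 0 < p) (hq : 0 < q)
    (hμ : μ ≤ q) (hν : ν ≤ p) (h : p * μ + q * ν = p * q + 1) (Y : R) :
    ∑ i ∈ Finset.range (p * q), (binaryCoeff p q μ ν i : R) * Y ^ i =
      (∑ x ∈ Finset.range μ, (Y ^ p) ^ x) * (∑ y ∈ Finset.range ν, (Y ^ q) ^ y) -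
      Y * ((∑ x ∈ Finset.range (q - μ), (Y ^ p) ^ x) *
        (∑ y ∈ Finset.range (p - ν), (Y ^ q) ^ y)) := by
  have hsplit : ∀ i ∈ Finset.range (p * q), (binaryCoeff p q μ ν i : R) * Y ^ i =
      (if binaryCoeff p q μ ν i = 1 then Y ^ i else 0) -
      (if binaryCoeff p q μ ν i = -1 then Y ^ i else 0) := by
    intro i _
    rcases binaryCoeff_cases hp hq h i with ⟨h1, -⟩ | ⟨h1, -⟩ | h1 <;> simp [h1]
  rw [Finset.sum_congr rfl hsplit, Finset.sum_sub_distrib, ← Finset.sum_filter,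
    ← Finset.sum_filter, Finset.sum_mul_sum, Finset.sum_mul_sum, ← Finset.sum_product',
    ← Finset.sum_product', Finset.mul_sum]
  congr 1
  · refine Finset.sum_nbij' (fun i => (i * μ % q, i * ν % p)) (fun z => p * z.1 + q * z.2)
      ?_ ?_ ?_ ?_ ?_
    · intro i hi
      simp only [Finset.mem_filter, Finset.mem_range, Finset.mem_product] at hi ⊢
      rcases binaryCoeff_cases hp hq h i with h1 | h1 | h1 <;> omega
    · rintro ⟨x, y⟩ hz
      simp only [Finset.mem_filter, Finset.mem_range, Finset.mem_product] at hz ⊢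
      obtain ⟨h1, h2⟩ := coord_of_lt h (hz.1.trans_le hμ) (hz.2.trans_le hν)
      have : p * x + p ≤ p * μ := by nlinarith
      have : q * y + q ≤ q * ν := by nlinarith
      have hlt : p * x + q * y < p * q := by omega
      refine ⟨hlt, ?_⟩
      simp [binaryCoeff, hlt, h1, h2, hz.1, hz.2]
    · intro i hi
      simp only [Finset.mem_filter, Finset.mem_range] at hi ⊢
      rcases binaryCoeff_cases hp hq h i with h1 | h1 | h1 <;> omega
    · rintro ⟨x, y⟩ hz
      simp only [Finset.mem_range, Finset.mem_product] at hz ⊢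
      obtain ⟨h1, h2⟩ := coord_of_lt h (hz.1.trans_le hμ) (hz.2.trans_le hν)
      rw [h1, h2]
    · intro i hi
      simp only [Finset.mem_filter, Finset.mem_range] at hi ⊢
      rw [← pow_mul, ← pow_mul, ← pow_add]
      congr 1
      rcases binaryCoeff_cases hp hq h i with h1 | h1 | h1 <;> omega
  · have hback : ∀ x y : ℕ, x < q - μ → y < p - ν →
        p * (x + μ) + q * (y + ν) = (p * x + q * y + 1) + p * q ∧
        p * x + q * y + 1 < p * q ∧
        (p * x + q * y + 1) * μ % q = x + μ ∧ (p * x + q * y + 1) * ν % p = y + ν := by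
      intro x y hx hy
      have e : p * (x + μ) + q * (y + ν) = (p * x + q * y + 1) + p * q := by
        linear_combination h
      obtain ⟨h1, h2⟩ := coord_of_lt (x := x + μ) (y := y + ν) h (by omega) (by omega)
      rw [e] at h1 h2
      have : p * (x + μ) + p ≤ p * q := by
        rw [← Nat.mul_succ]; exact Nat.mul_le_mul_left _ (by omega)
      have : q * (y + ν) + q ≤ p * q := by
        rw [← Nat.mul_succ, mul_comm p q]; exact Nat.mul_le_mul_left _ (by omega)
      refine ⟨e, by omega, ?_, ?_⟩
      · rw [← h1, add_mul _ (p * q), mul_comm p q, mul_assoc q, Nat.add_mul_mod_self_left]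
      · rw [← h2, add_mul _ (p * q), mul_assoc p, Nat.add_mul_mod_self_left]
    refine Finset.sum_nbij' (fun i => (i * μ % q - μ, i * ν % p - ν))
      (fun z => p * z.1 + q * z.2 + 1) ?_ ?_ ?_ ?_ ?_
    · intro i hi
      simp only [Finset.mem_filter, Finset.mem_range, Finset.mem_product] at hi ⊢
      have := Nat.mod_lt (i * μ) hq
      have := Nat.mod_lt (i * ν) hp
      rcases binaryCoeff_cases hp hq h i with h1 | h1 | h1 <;> omega
    · rintro ⟨x, y⟩ hz
      simp only [Finset.mem_filter, Finset.mem_range, Finset.mem_product] at hz ⊢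
      obtain ⟨-, hlt, h1, h2⟩ := hback x y hz.1 hz.2
      refine ⟨hlt, ?_⟩
      simp [binaryCoeff, hlt, h1, h2]
    · intro i hi
      simp only [Finset.mem_filter, Finset.mem_range] at hi ⊢
      rcases binaryCoeff_cases hp hq h i with h1 | h1 | h1
      · omega
      · have : p * (i * μ % q) = p * (i * μ % q - μ) + p * μ := by
          rw [← mul_add, Nat.sub_add_cancel h1.2.1]
        have : q * (i * ν % p) = q * (i * ν % p - ν) + q * ν := by
          rw [← mul_add, Nat.sub_add_cancel h1.2.2.1]
        omega
      · omega
    · rintro ⟨x, y⟩ hz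
      simp only [Finset.mem_range, Finset.mem_product] at hz ⊢
      obtain ⟨-, -, h1, h2⟩ := hback x y hz.1 hz.2
      rw [h1, h2]
      simp
    · intro i hi
      simp only [Finset.mem_filter, Finset.mem_range] at hi ⊢
      rw [← pow_mul, ← pow_mul, ← pow_add, ← pow_succ']
      congr 1
      rcases binaryCoeff_cases hp hq h i with h1 | h1 | h1
      · omega
      · have : p * (i * μ % q) = p * (i * μ % q - μ) + p * μ := by
          rw [← mul_add, Nat.sub_add_cancel h1.2.1]
        have : q * (i * ν % p) = q * (i * ν % p - ν) + q * ν := by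
          rw [← mul_add, Nat.sub_add_cancel h1.2.2.1]
        omega
      · omega

lemma sum_binaryCoeff_mul_pow_mul {R : Type*} [CommRing R] {p q μ ν : ℕ} (hp : 0 < p)
    (hq : 0 < q) (hμ : μ ≤ q) (hν : ν ≤ p) (h : p * μ + q * ν = p * q + 1) (Y : R) :
    (∑ i ∈ Finset.range (p * q), (binaryCoeff p q μ ν i : R) * Y ^ i) *
      ((1 - Y ^ p) * (1 - Y ^ q)) = (1 - Y) * (1 - Y ^ (p * q)) := by
  rw [sum_binaryCoeff_mul_pow hp hq hμ hν h]
  have g1 := mul_neg_geom_sum (Y ^ p) μ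
  have g2 := mul_neg_geom_sum (Y ^ q) ν
  have g3 := mul_neg_geom_sum (Y ^ p) (q - μ)
  have g4 := mul_neg_geom_sum (Y ^ q) (p - ν)
  obtain ⟨a, rfl⟩ := Nat.exists_eq_add_of_le hμ
  obtain ⟨b, hb⟩ := Nat.exists_eq_add_of_le hν
  have ha' : μ + a - μ = a := by omega
  have hb' : p - ν = b := by omega
  rw [ha'] at g3 ⊢
  rw [hb'] at g4 ⊢
  have hpa : p * a + 1 = (μ + a) * ν := by linear_combination -h
  have hqb : (μ + a) * b + 1 = p * μ := by
    have : p * (μ + a) = (ν + b) * (μ + a) := by rw [← hb]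
    linear_combination -this - h
  have e1 : Y * (Y ^ p) ^ a = (Y ^ (μ + a)) ^ ν := by
    rw [← pow_mul, ← pow_mul, ← pow_succ', hpa]
  have e2 : Y * (Y ^ (μ + a)) ^ b = (Y ^ p) ^ μ := by
    rw [← pow_mul, ← pow_mul, ← pow_succ', hqb]
  have e3 : (Y ^ p) ^ μ * (Y ^ (μ + a)) ^ ν = Y * Y ^ (p * (μ + a)) := by
    rw [← pow_mul, ← pow_mul, ← pow_add, ← pow_succ', h]
  have e4 : (Y ^ p) ^ a * (Y ^ p) ^ μ = Y ^ (p * (μ + a)) := by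
    rw [← pow_mul, ← pow_mul, ← pow_add]; congr 1; ring
  generalize (∑ x ∈ Finset.range μ, (Y ^ p) ^ x) = S1 at *
  generalize (∑ x ∈ Finset.range ν, (Y ^ (μ + a)) ^ x) = S2 at *
  generalize (∑ x ∈ Finset.range a, (Y ^ p) ^ x) = S3 at *
  generalize (∑ x ∈ Finset.range b, (Y ^ (μ + a)) ^ x) = S4 at *
  calc _ = ((1 - Y ^ p) * S1) * ((1 - Y ^ (μ + a)) * S2) -
        Y * (((1 - Y ^ p) * S3) * ((1 - Y ^ (μ + a)) * S4)) := by ring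
    _ = _ := by
      rw [g1, g2, g3, g4]
      linear_combination e3 + e1 + e2 - e4 - (Y ^ p) ^ a * e2

lemma add_lt_mul_of_three_le {p q : ℕ} (hp : 3 ≤ p) (hq : 3 ≤ q) : p + q + 1 < p * q := by
  nlinarith

lemma sub_emod_eq {N a m : ℤ} (ha : 0 ≤ a) (haN : a < N) :
    (m - a) % N = if a ≤ m % N then m % N - a else m % N - a + N := by
  have h0 := Int.emod_nonneg m (show N ≠ 0 by omega)
  have h1 := Int.emod_lt_of_pos m (show 0 < N by omega)
  rw [Int.sub_emod, Int.emod_eq_of_lt ha haN]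
  split_ifs
  · exact Int.emod_eq_of_lt (by omega) (by omega)
  · rw [← Int.add_emod_right]
    exact Int.emod_eq_of_lt (by omega) (by omega)

lemma periodicCoeff_congr {p q : ℕ} {m n : ℤ} (h : m ≡ n [ZMOD (p * q : ℕ)]) :
    periodicCoeff p q m = periodicCoeff p q n := by
  unfold periodicCoeff
  rw [h]

lemma periodicCoeff_reflect {p q : ℕ} (hp : 3 ≤ p) (hq : 3 ≤ q) (m : ℤ) :
    periodicCoeff p q (p + q - 1 - m) = -periodicCoeff p q m := by
  have hN := add_lt_mul_of_three_le hp hq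
  have h0 := Int.emod_nonneg m (show ((p * q : ℕ) : ℤ) ≠ 0 by omega)
  have h1 := Int.emod_lt_of_pos m (show 0 < ((p * q : ℕ) : ℤ) by omega)
  have h2 : ((p : ℤ) + q - 1 - m) % (p * q : ℕ) =
      if m % (p * q : ℕ) ≤ p + q - 1 then (p : ℤ) + q - 1 - m % (p * q : ℕ)
      else (p : ℤ) + q - 1 - m % (p * q : ℕ) + (p * q : ℕ) := by
    rw [← Int.sub_emod_emod, sub_emod_eq h0 h1,
      Int.emod_eq_of_lt (a := (p : ℤ) + q - 1) (by omega) (by omega)]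
  unfold periodicCoeff
  rw [h2]
  split_ifs <;> omega

lemma periodicCoeff_sub_pred {p q : ℕ} (hp : 3 ≤ p) (hq : 3 ≤ q) (m : ℤ) :
    periodicCoeff p q m - periodicCoeff p q (m - 1) =
      (if m % (p * q : ℕ) = 0 then 1 else 0) - (if (m - p) % (p * q : ℕ) = 0 then 1 else 0) -
      (if (m - q) % (p * q : ℕ) = 0 then 1 else 0) +
      (if (m - (p + q : ℕ)) % (p * q : ℕ) = 0 then 1 else 0) := by
  have hN := add_lt_mul_of_three_le hp hq
  have h0 := Int.emod_nonneg m (show ((p * q : ℕ) : ℤ) ≠ 0 by omega)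
  have h1 := Int.emod_lt_of_pos m (show 0 < ((p * q : ℕ) : ℤ) by omega)
  unfold periodicCoeff
  rw [sub_emod_eq (a := 1) (by omega) (by omega), sub_emod_eq (a := p) (by omega) (by omega),
    sub_emod_eq (a := q) (by omega) (by omega),
    sub_emod_eq (a := (p + q : ℕ)) (by omega) (by omega)]
  generalize m % ((p * q : ℕ) : ℤ) = j at *
  have hN' : (p + q + 1 : ℤ) < (p * q : ℕ) := by exact_mod_cast hN
  generalize ((p * q : ℕ) : ℤ) = N at *
  clear hN
  have e1 : ((if j < p then 1 else 0) -
      (if (if 1 ≤ j then j - 1 else j - 1 + N) < p then 1 else 0) : ℤ) =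
      (if j = 0 then 1 else 0) - (if (if p ≤ j then j - p else j - p + N) = 0 then 1 else 0) := by
    split_ifs <;> omega
  have e2 : ((if q ≤ j ∧ j < p + q then 1 else 0) -
      (if q ≤ (if 1 ≤ j then j - 1 else j - 1 + N) ∧
        (if 1 ≤ j then j - 1 else j - 1 + N) < p + q then 1 else 0) : ℤ) =
      (if (if q ≤ j then j - q else j - q + N) = 0 then 1 else 0) -
      (if (if (p + q : ℕ) ≤ j then j - (p + q : ℕ) else j - (p + q : ℕ) + N) = 0
        then 1 else 0) := by
    split_ifs <;> omega
  linear_combination e1 - e2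

/-- Reflection: replacing `r` by `-r` modulo `p * q` negates the truncated convolution. -/
lemma truncConv_neg {p q : ℕ} (hp : 3 ≤ p) (hq : 3 ≤ q) (μ ν : ℕ) {r s : ℤ}
    (h : r ≡ -s [ZMOD (p * q : ℕ)]) (t : ℤ) (k : ℕ) :
    truncConv p q μ ν s t k = -truncConv p q μ ν r (p + q - 1 - t) k := by
  unfold truncConv
  rw [← Finset.sum_neg_distrib]
  refine Finset.sum_congr rfl fun i _ => ?_
  rw [← mul_neg, ← periodicCoeff_reflect hp hq]
  congr 1
  apply periodicCoeff_congr
  have e : (p + q - 1 - (p + q - 1 - t - r * i) : ℤ) = t + r * i := by ring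
  rw [e, sub_eq_add_neg, ← neg_mul]
  exact ((h.symm).mul_right _).add_left _

lemma sum_binaryCoeff_dvd {p q μ ν : ℕ} (hN : 0 < p * q) {r ρ : ℤ}
    (hρ : r * ρ ≡ 1 [ZMOD (p * q : ℕ)]) (t : ℤ) (k : ℕ) :
    ∑ i ∈ Finset.range k, binaryCoeff p q μ ν i *
        (if (t - r * i) % (p * q : ℕ) = 0 then 1 else 0) =
      if (t * ρ % (p * q : ℕ)).toNat < k then
        binaryCoeff p q μ ν (t * ρ % (p * q : ℕ)).toNat else 0 := by
  have h0 := Int.emod_nonneg (t * ρ) (show ((p * q : ℕ) : ℤ) ≠ 0 by omega)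
  have h1 := Int.emod_lt_of_pos (t * ρ) (show 0 < ((p * q : ℕ) : ℤ) by omega)
  have hterm : ∀ i ∈ Finset.range k, binaryCoeff p q μ ν i *
      (if (t - r * i) % (p * q : ℕ) = 0 then 1 else 0) =
      if (t * ρ % (p * q : ℕ)).toNat = i then binaryCoeff p q μ ν i else 0 := by
    intro i _
    by_cases hi : i < p * q
    · have : (t - r * i) % (p * q : ℕ) = 0 ↔ (t * ρ % (p * q : ℕ)).toNat = i := by
        have e1 : (t - r * i) % (p * q : ℕ) = 0 ↔ t ≡ r * i [ZMOD (p * q : ℕ)] := by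
          rw [← Int.dvd_iff_emod_eq_zero, Int.modEq_comm, Int.modEq_iff_dvd]
        have e2 : (t * ρ % (p * q : ℕ)).toNat = i ↔ t * ρ ≡ i [ZMOD (p * q : ℕ)] := by
          unfold Int.ModEq
          rw [Int.emod_eq_of_lt (a := (i : ℤ)) (by omega) (by omega)]
          omega
        rw [e1, e2]
        constructor
        · intro ht
          have a1 := ht.mul_right ρ
          have a2 := hρ.mul_right (i : ℤ)
          rw [one_mul] at a2
          refine a1.trans ?_
          convert a2 using 1
          ring
        · intro ht
          have a1 := ht.mul_left r
          have a2 := hρ.mul_right t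
          rw [one_mul] at a2
          refine a2.symm.trans ?_
          convert a1 using 1
          ring
      simp only [this, mul_ite, mul_one, mul_zero]
    · have : binaryCoeff p q μ ν i = 0 := by simp [binaryCoeff, hi]
      simp [this]
  rw [Finset.sum_congr rfl hterm, Finset.sum_ite_eq]
  simp

lemma abs_truncConv_sub_pred_le_one {p q μ ν : ℕ} (hp : 3 ≤ p) (hq : 3 ≤ q)
    (h : p * μ + q * ν = p * q + 1) {r : ℕ} (hr : r.Coprime (p * q)) (t : ℤ) (k : ℕ) :
    |truncConv p q μ ν r t k - truncConv p q μ ν r (t - 1) k| ≤ 1 := by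
  have hN := add_lt_mul_of_three_le hp hq
  obtain ⟨ρ, hρ⟩ : ∃ ρ : ℤ, (r : ℤ) * ρ ≡ 1 [ZMOD (p * q : ℕ)] := by
    obtain ⟨m, -, hm⟩ := Nat.exists_mul_mod_eq_one_of_coprime hr (by omega)
    refine ⟨m, ?_⟩
    have : r * m ≡ 1 [MOD (p * q)] := by
      rw [Nat.ModEq, hm, Nat.mod_eq_of_lt (by omega)]
    exact_mod_cast (Int.natCast_modEq_iff.mpr this)
  have hsum : truncConv p q μ ν r t k - truncConv p q μ ν r (t - 1) k =
      ∑ i ∈ Finset.range k, binaryCoeff p q μ ν i *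
        (if (t - r * i) % (p * q : ℕ) = 0 then 1 else 0) -
      ∑ i ∈ Finset.range k, binaryCoeff p q μ ν i *
        (if (t - p - r * i) % (p * q : ℕ) = 0 then 1 else 0) -
      ∑ i ∈ Finset.range k, binaryCoeff p q μ ν i *
        (if (t - q - r * i) % (p * q : ℕ) = 0 then 1 else 0) +
      ∑ i ∈ Finset.range k, binaryCoeff p q μ ν i *
        (if (t - (p + q : ℕ) - r * i) % (p * q : ℕ) = 0 then 1 else 0) := by
    unfold truncConv
    rw [← Finset.sum_sub_distrib, ← Finset.sum_sub_distrib, ← Finset.sum_sub_distrib,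
      ← Finset.sum_add_distrib]
    refine Finset.sum_congr rfl fun i _ => ?_
    have := periodicCoeff_sub_pred hp hq (t - r * i)
    rw [sub_right_comm t (1 : ℤ), sub_right_comm t (p : ℤ), sub_right_comm t (q : ℤ),
      sub_right_comm t ((p + q : ℕ) : ℤ), ← mul_sub, this]
    ring
  rw [hsum]
  simp only [sum_binaryCoeff_dvd (show 0 < p * q by omega) hρ]
  have hcast : ∀ u : ℤ, (((u * ρ % (p * q : ℕ)).toNat : ℕ) : ℤ) ≡ u * ρ [ZMOD (p * q : ℕ)] := by
    intro u
    rw [Int.toNat_of_nonneg (Int.emod_nonneg _ (by omega))]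
    exact Int.mod_modEq _ _
  have hx : ∀ u v : ℤ, u ≡ v [ZMOD q] →
      (u * ρ % (p * q : ℕ)).toNat * μ % q = (v * ρ % (p * q : ℕ)).toNat * μ % q := by
    intro u v huv
    have hd : ((q : ℕ) : ℤ) ∣ ((p * q : ℕ) : ℤ) := by exact_mod_cast Dvd.intro_left p rfl
    have := ((hcast u).of_dvd hd).trans ((huv.mul_right ρ).trans ((hcast v).of_dvd hd).symm)
    exact (Int.natCast_modEq_iff.mp this).mul_right μ
  have hy : ∀ u v : ℤ, u ≡ v [ZMOD p] →
      (u * ρ % (p * q : ℕ)).toNat * ν % p = (v * ρ % (p * q : ℕ)).toNat * ν % p := by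
    intro u v huv
    have hd : ((p : ℕ) : ℤ) ∣ ((p * q : ℕ) : ℤ) := by exact_mod_cast Dvd.intro q rfl
    have := ((hcast u).of_dvd hd).trans ((huv.mul_right ρ).trans ((hcast v).of_dvd hd).symm)
    exact (Int.natCast_modEq_iff.mp this).mul_right ν
  have hlt : ∀ u : ℤ, (u * ρ % (p * q : ℕ)).toNat < p * q := by
    intro u
    have := Int.emod_lt_of_pos (u * ρ) (show 0 < ((p * q : ℕ) : ℤ) by omega)
    omega
  have x13 := hx (t - q) t (by simp [Int.modEq_iff_dvd])
  have x24 := hx (t - (p + q : ℕ)) (t - p) (by simp [Int.modEq_iff_dvd])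
  have y12 := hy (t - p) t (by simp [Int.modEq_iff_dvd])
  have y34 := hy (t - (p + q : ℕ)) (t - q) (by simp [Int.modEq_iff_dvd])
  have l1 := hlt t
  have l2 := hlt (t - p)
  have l3 := hlt (t - q)
  have l4 := hlt (t - (p + q : ℕ))
  generalize (t * ρ % (p * q : ℕ)).toNat = i1 at *
  generalize ((t - p) * ρ % (p * q : ℕ)).toNat = i2 at *
  generalize ((t - q) * ρ % (p * q : ℕ)).toNat = i3 at *
  generalize ((t - (p + q : ℕ)) * ρ % (p * q : ℕ)).toNat = i4 at *
  have c1 := binaryCoeff_cases (by omega) (by omega) h i1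
  have c2 := binaryCoeff_cases (by omega) (by omega) h i2
  have c3 := binaryCoeff_cases (by omega) (by omega) h i3
  have c4 := binaryCoeff_cases (by omega) (by omega) h i4
  have hb : ∀ i < p * q, binaryCoeff p q μ ν i =
      (if i * μ % q < μ then 1 else 0) + (if i * ν % p < ν then 1 else 0) - 1 :=
    fun i hi => by rw [binaryCoeff, if_pos hi]
  have b1 := hb i1 l1
  have b2 := hb i2 l2
  have b3 := hb i3 l3
  have b4 := hb i4 l4
  rw [x24, y34] at c4 b4
  rw [x13] at c3 b3
  rw [y12] at c2 b2
  clear hb hx hy hcast hlt hsum x13 x24 y12 y34 hρ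
  generalize i1 * μ % q = x at *
  generalize i2 * μ % q = x' at *
  generalize i1 * ν % p = y at *
  generalize i3 * ν % p = y' at *
  generalize p * x = px at *
  generalize p * x' = px' at *
  generalize q * y = qy at *
  generalize q * y' = qy' at *
  rw [abs_le]
  by_cases ux : x < μ <;> by_cases ux' : x' < μ <;> by_cases vy : y < ν <;>
    by_cases vy' : y' < ν <;> simp only [ux, ux', vy, vy', if_true, if_false] at b1 b2 b3 b4 <;>
    simp only [b1, b2, b3, b4] at c1 c2 c3 c4 ⊢ <;> split_ifs <;> omega

lemma truncConv_succ (p q μ ν : ℕ) (r t : ℤ) (k : ℕ) :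
    truncConv p q μ ν r t (k + 1) =
      truncConv p q μ ν r t k + binaryCoeff p q μ ν k * periodicCoeff p q (t - r * k) := by
  rw [truncConv, Finset.sum_range_succ, truncConv]

lemma truncConv_congr {p q : ℕ} (μ ν : ℕ) (r : ℤ) {t u : ℤ} (h : t ≡ u [ZMOD (p * q : ℕ)])
    (k : ℕ) : truncConv p q μ ν r t k = truncConv p q μ ν r u k :=
  Finset.sum_congr rfl fun _ _ => by rw [periodicCoeff_congr (h.sub_right _)]

lemma abs_truncConv_div_succ_sub_le_one {p q μ ν : ℕ} (hp : 3 ≤ p) (hq : 3 ≤ q)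
    (h : p * μ + q * ν = p * q + 1) {r : ℕ} (hr : r.Coprime (p * q)) (n : ℕ) :
    |truncConv p q μ ν r (n + 1 : ℕ) ((n + 1) / r + 1) -
      truncConv p q μ ν r n (n / r + 1)| ≤ 1 := by
  have hN := add_lt_mul_of_three_le hp hq
  have hstep := abs_truncConv_sub_pred_le_one hp hq h hr (n + 1 : ℕ) ((n + 1) / r + 1)
  have e : ((n + 1 : ℕ) : ℤ) - 1 = n := by push_cast; ring
  rw [e] at hstep
  suffices hs : truncConv p q μ ν r n ((n + 1) / r + 1) = truncConv p q μ ν r n (n / r + 1) by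
    rwa [hs] at hstep
  rw [Nat.succ_div]
  split_ifs with hd
  · rw [truncConv_succ]
    have hdiv : r * (n / r + 1) = n + 1 := by
      have := Nat.mul_div_cancel' hd
      rwa [Nat.succ_div, if_pos hd] at this
    have : (n : ℤ) - r * (n / r + 1 : ℕ) = -1 := by
      have : (r : ℤ) * (n / r + 1 : ℕ) = n + 1 := by exact_mod_cast hdiv
      omega
    rw [this]
    have hz : periodicCoeff p q (-1) = 0 := by
      have : (-1 : ℤ) % (p * q : ℕ) = (p * q : ℕ) - 1 := by
        rw [← Int.add_emod_right]
        rw [Int.emod_eq_of_lt] <;> omega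
      unfold periodicCoeff
      rw [this]
      split_ifs <;> omega
    rw [hz]
    ring
  · rfl

lemma exists_eq_of_abs_sub_le_one {a : ℕ → ℤ} (ha : ∀ n, |a (n + 1) - a n| ≤ 1) {m n : ℕ}
    {v : ℤ} (h1 : a m ≤ v) (h2 : v ≤ a n) : ∃ k, a k = v := by
  by_contra! hne
  rcases le_total m n with hmn | hmn
  · have : ∀ k, m ≤ k → a k < v := by
      intro k hk
      induction k, hk using Nat.le_induction with
      | base => exact lt_of_le_of_ne h1 (hne m)
      | succ k _ ih =>
        have := abs_le.mp (ha k)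
        have := hne (k + 1)
        omega
    have := this n hmn
    omega
  · have : ∀ k, n ≤ k → v < a k := by
      intro k hk
      induction k, hk using Nat.le_induction with
      | base => exact lt_of_le_of_ne h2 (hne n).symm
      | succ k _ ih =>
        have := abs_le.mp (ha k)
        have := hne (k + 1)
        omega
    have := this m hmn
    omega

lemma truncConv_mem_range {p q μ ν : ℕ} (hp : 3 ≤ p) (hq : 3 ≤ q) (hμ : μ ≤ q) (hν : ν ≤ p)
    (h : p * μ + q * ν = p * q + 1) {r : ℕ} (hrp : p < r) (hrq : q < r)
    (hr : r.Coprime (p * q)) (hzero : ∃ n : ℕ, truncConv p q μ ν r n (n / r + 1) = 0)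
    (t : ℤ) (k : ℕ) : ∃ n : ℕ, truncConv p q μ ν r n (n / r + 1) = truncConv p q μ ν r t k := by
  have hN := add_lt_mul_of_three_le hp hq
  induction k with
  | zero => simpa [truncConv] using hzero
  | succ k ih =>
    have h0 := Int.emod_nonneg (t - r * k) (show ((p * q : ℕ) : ℤ) ≠ 0 by omega)
    have h1 := Int.emod_lt_of_pos (t - r * k) (show 0 < ((p * q : ℕ) : ℤ) by omega)
    obtain ⟨j, hj⟩ : ∃ j : ℕ, (t - r * k) % (p * q : ℕ) = j := Int.eq_ofNat_of_zero_le h0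
    have ht : ((r * k + j : ℕ) : ℤ) ≡ t [ZMOD (p * q : ℕ)] := by
      have := (Int.mod_modEq (t - r * k) (p * q : ℕ)).add_left (r * k)
      rw [hj] at this
      push_cast at this ⊢
      simpa using this
    by_cases hjr : j < r
    · refine ⟨r * k + j, ?_⟩
      rw [truncConv_congr μ ν r ht, Nat.mul_add_div (by omega), Nat.div_eq_of_lt hjr, add_zero]
    · by_cases hjpq : j < p + q
      · have hc : periodicCoeff p q (t - r * k) = -1 := by
          unfold periodicCoeff
          rw [hj]
          split_ifs <;> omega
        have hc' : periodicCoeff p q (t - r * (k + 1 : ℕ)) = 1 := by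
          have e : t - (r : ℤ) * (k + 1 : ℕ) = t - r * k - r := by push_cast; ring
          unfold periodicCoeff
          rw [e, sub_emod_eq (by omega) (by omega), hj]
          split_ifs <;> omega
        have hk1 := truncConv_succ p q μ ν r t k
        have hk2 := truncConv_succ p q μ ν r t (k + 1)
        rw [hc] at hk1
        rw [hc'] at hk2
        have hatt : truncConv p q μ ν r (r * k + j : ℕ) ((r * k + j) / r + 1) =
            truncConv p q μ ν r t (k + 1 + 1) := by
          have e : (r * k + j) / r = k + 1 := by
            rw [Nat.div_eq_of_lt_le] <;> nlinarith
          rw [e, truncConv_congr μ ν r ht]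
        obtain ⟨n, hn⟩ := ih
        have hjump := abs_truncConv_div_succ_sub_le_one hp hq h hr
        have hsucc := binaryCoeff_succ (by omega) (by omega) hμ hν h k
        have hb := binaryCoeff_cases (by omega) (by omega) h k
        have hb' := binaryCoeff_cases (by omega) (by omega) h (k + 1)
        have hjump' := fun m n => exists_eq_of_abs_sub_le_one
          (a := fun n : ℕ => truncConv p q μ ν r n (n / r + 1)) hjump (m := m) (n := n)
          (v := truncConv p q μ ν r t (k + 1))
        replace hb : binaryCoeff p q μ ν k = 1 ∨ binaryCoeff p q μ ν k = -1 ∨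
            binaryCoeff p q μ ν k = 0 := hb.imp And.left (.imp_left And.left)
        replace hb' : binaryCoeff p q μ ν (k + 1) = 1 ∨ binaryCoeff p q μ ν (k + 1) = -1 ∨
            binaryCoeff p q μ ν (k + 1) = 0 := hb'.imp And.left (.imp_left And.left)
        rcases hb with hb | hb | hb
        · have := hsucc (by omega)
          exact hjump' (r * k + j) n (by omega) (by omega)
        · have := hsucc (by omega)
          exact hjump' n (r * k + j) (by omega) (by omega)
        · exact ⟨n, by rw [hn, hk1, hb]; ring⟩
      · have hc : periodicCoeff p q (t - r * k) = 0 := by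
          unfold periodicCoeff
          rw [hj]
          split_ifs <;> omega
        rw [truncConv_succ, hc, mul_zero, add_zero]
        exact ih

lemma mk_periodicCoeff_mul {p q : ℕ} (hp : 3 ≤ p) (hq : 3 ≤ q) :
    PowerSeries.mk (fun n : ℕ => periodicCoeff p q n) * (1 - PowerSeries.X ^ (p * q)) *
      (1 - PowerSeries.X) = (1 - PowerSeries.X ^ p) * (1 - PowerSeries.X ^ q) := by
  have hN := add_lt_mul_of_three_le hp hq
  have key : PowerSeries.mk (fun n : ℕ => periodicCoeff p q n) * (1 - PowerSeries.X ^ (p * q)) =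
      (∑ i ∈ Finset.range p, (PowerSeries.X : PowerSeries ℤ) ^ i) * (1 - PowerSeries.X ^ q) := by
    have hgeom : ∀ n : ℕ, PowerSeries.coeff n
        (∑ i ∈ Finset.range p, (PowerSeries.X : PowerSeries ℤ) ^ i) = if n < p then 1 else 0 := by
      intro n
      simp [PowerSeries.coeff_X_pow]
    ext n
    rw [mul_sub, mul_sub, mul_one, mul_one, map_sub, map_sub, PowerSeries.coeff_mul_X_pow',
      PowerSeries.coeff_mul_X_pow', hgeom, hgeom, PowerSeries.coeff_mk]
    by_cases hn : n < p * q
    · rw [if_neg (by omega)]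
      unfold periodicCoeff
      rw [Int.emod_eq_of_lt (by omega) (by omega)]
      split_ifs <;> omega
    · have hper : periodicCoeff p q (n - p * q : ℕ) = periodicCoeff p q n := by
        apply periodicCoeff_congr
        rw [Int.modEq_iff_dvd]
        exact ⟨1, by omega⟩
      rw [if_pos (by omega), PowerSeries.coeff_mk, hper]
      split_ifs <;> omega
  rw [key, mul_right_comm, geom_sum_mul_neg]

lemma one_sub_X_pow_ne_zero {n : ℕ} (hn : 0 < n) :
    (1 : PowerSeries ℤ) - PowerSeries.X ^ n ≠ 0 := by
  intro h0
  have := congrArg (PowerSeries.coeff 0) h0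
  simp [PowerSeries.coeff_zero_eq_constantCoeff, hn.ne'] at this

/-- The coefficients of `Q_{p,q,r}` are truncated convolutions. -/
lemma coeff_eq_truncConv {p q μ ν : ℕ} (hp : 3 ≤ p) (hq : 3 ≤ q) (hμ : μ ≤ q) (hν : ν ≤ p)
    (h : p * μ + q * ν = p * q + 1) {r : ℕ} (hr0 : 0 < r) {Q : Polynomial ℤ}
    (hQ : ternaryId p q r Q) (n : ℕ) : Q.coeff n = truncConv p q μ ν r n (n / r + 1) := by
  have hN := add_lt_mul_of_three_le hp hq
  have hQ' := congrArg (Polynomial.coeToPowerSeries.ringHom (R := ℤ)) hQ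
  simp only [map_mul, map_sub, map_pow, map_one, Polynomial.coeToPowerSeries.ringHom_apply,
    Polynomial.coe_X] at hQ'
  have hB := sum_binaryCoeff_mul_pow_mul (by omega) (by omega) hμ hν h
    ((PowerSeries.X : PowerSeries ℤ) ^ r)
  simp only [← pow_mul] at hB
  have hM := mk_periodicCoeff_mul hp hq
  have hfac : (Q : PowerSeries ℤ) =
      (∑ i ∈ Finset.range (p * q), (binaryCoeff p q μ ν i : PowerSeries ℤ) *
        PowerSeries.X ^ (r * i)) * PowerSeries.mk (fun n : ℕ => periodicCoeff p q n) := by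
    have n1 := one_sub_X_pow_ne_zero (show 0 < r * p by positivity)
    have n2 := one_sub_X_pow_ne_zero (show 0 < r * q by positivity)
    have n3 := one_sub_X_pow_ne_zero (show 0 < p * q by positivity)
    have n4 := one_sub_X_pow_ne_zero (show 0 < 1 by positivity)
    rw [pow_one] at n4
    refine mul_right_cancel₀ (mul_ne_zero (mul_ne_zero n1 n2) (mul_ne_zero n3 n4)) ?_
    rw [mul_comm q r, mul_comm (p * q) r] at hQ'
    linear_combination hQ' - PowerSeries.mk (fun n : ℕ => periodicCoeff p q n) *
      (1 - PowerSeries.X ^ (p * q)) * (1 - PowerSeries.X) * hB -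
      (1 - PowerSeries.X ^ r) * (1 - PowerSeries.X ^ (r * (p * q))) * hM
  rw [← Polynomial.coeff_coe, hfac, Finset.sum_mul, map_sum]
  have hterm : ∀ i : ℕ, PowerSeries.coeff n ((binaryCoeff p q μ ν i : PowerSeries ℤ) *
      PowerSeries.X ^ (r * i) * PowerSeries.mk (fun n : ℕ => periodicCoeff p q n)) =
      if i < n / r + 1 then binaryCoeff p q μ ν i * periodicCoeff p q (n - r * i) else 0 := by
    intro i
    rw [mul_assoc, ← map_intCast (PowerSeries.C (R := ℤ)), PowerSeries.coeff_C_mul,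
      PowerSeries.coeff_X_pow_mul', PowerSeries.coeff_mk]
    have hiff : r * i ≤ n ↔ i < n / r + 1 := by
      rw [Nat.lt_succ_iff, Nat.le_div_iff_mul_le hr0, mul_comm]
    simp only [hiff]
    split_ifs with hi
    · rw [Nat.cast_sub (hiff.mpr hi)]
      simp
    · simp
  simp only [hterm]
  rw [← Finset.sum_filter, truncConv]
  refine Finset.sum_subset_zero_on_sdiff ?_ ?_ ?_
  · intro i hi
    simp only [Finset.mem_filter] at hi
    exact Finset.mem_range.mpr hi.2
  · intro i hi
    simp only [Finset.mem_sdiff, Finset.mem_filter, Finset.mem_range, not_and] at hi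
    have : ¬ i < p * q := fun hlt => hi.2 hlt hi.1
    simp [binaryCoeff, this]
  · intro i _
    rfl

lemma natDegree_le_of_ternaryId {p q r : ℕ} (hp : 0 < p) (hq : 0 < q) (hr : 0 < r)
    {Q : Polynomial ℤ} (hQ : ternaryId p q r Q) :
    Q.natDegree ≤ (p - 1) * (q - 1) * (r - 1) := by
  have hm : ∀ n : ℕ, 0 < n → ((X : Polynomial ℤ) ^ n - 1).Monic := fun n hn =>
    monic_X_pow_sub_C 1 hn.ne'
  have hd : ∀ n : ℕ, ((X : Polynomial ℤ) ^ n - 1).natDegree = n := fun n =>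
    natDegree_X_pow_sub_C (r := (1 : ℤ))
  have h1 := hm (q * r) (by positivity)
  have h2 := hm (r * p) (by positivity)
  have h3 := hm (p * q) (by positivity)
  have h4 := hm 1 (by positivity)
  have h5 := hm (p * q * r) (by positivity)
  have h6 := hm r hr
  have h7 := hm q hq
  have h8 := hm p hp
  have hQ0 : Q ≠ 0 := by
    rintro rfl
    simp only [ternaryId, zero_mul] at hQ
    exact (((h5.mul h6).mul h7).mul h8).ne_zero hQ.symm
  have hQ' := congrArg natDegree hQ
  rw [pow_one] at h4
  have hd1 : ((X : Polynomial ℤ) - 1).natDegree = 1 := natDegree_X_sub_C 1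
  rw [mul_comm Q, (((h1.mul h2).mul h3).mul h4).natDegree_mul' hQ0,
    ((h1.mul h2).mul h3).natDegree_mul h4,
    (h1.mul h2).natDegree_mul h3, h1.natDegree_mul h2, ((h5.mul h6).mul h7).natDegree_mul h8,
    (h5.mul h6).natDegree_mul h7, h5.natDegree_mul h6] at hQ'
  simp only [hd, hd1] at hQ'
  obtain ⟨a, rfl⟩ := Nat.exists_eq_add_of_lt hp
  obtain ⟨b, rfl⟩ := Nat.exists_eq_add_of_lt hq
  obtain ⟨c, rfl⟩ := Nat.exists_eq_add_of_lt hr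
  simp only [zero_add, Nat.add_sub_cancel] at *
  apply le_of_eq
  linear_combination hQ'

lemma setOf_coeff_eq_range_truncConv {p q μ ν : ℕ} (hp : 3 ≤ p) (hq : 3 ≤ q) (hpq : p ≠ q)
    (hμ : μ ≤ q) (hν : ν ≤ p) (h : p * μ + q * ν = p * q + 1) {r : ℕ} (hrp : p < r) (hrq : q < r)
    (hr : r.Coprime (p * q)) {Q : Polynomial ℤ} (hQ : ternaryId p q r Q) (a : ℤ) :
    (∃ m ≤ (p - 1) * (q - 1) * (r - 1), Q.coeff m = a) ↔
      ∃ (t : ℤ) (k : ℕ), truncConv p q μ ν r t k = a := by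
  have hN := add_lt_mul_of_three_le hp hq
  have hcoeff := coeff_eq_truncConv hp hq hμ hν h (show 0 < r by omega) hQ
  have hzero : ∃ m ≤ (p - 1) * (q - 1) * (r - 1), Q.coeff m = 0 := by
    refine ⟨min p q, ?_, ?_⟩
    · have : 1 ≤ (p - 1) * (q - 1) := Nat.mul_pos (by omega) (by omega)
      calc min p q ≤ r - 1 := by omega
        _ ≤ _ := Nat.le_mul_of_pos_left _ this
    · rw [hcoeff, Nat.div_eq_of_lt (by omega), truncConv_succ]
      have : periodicCoeff p q ((min p q : ℕ) - r * (0 : ℕ)) = 0 := by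
        unfold periodicCoeff
        rw [Nat.cast_zero, mul_zero, sub_zero, Int.emod_eq_of_lt (by omega) (by omega)]
        split_ifs <;> omega
      rw [this]
      simp [truncConv]
  constructor
  · rintro ⟨m, -, rfl⟩
    exact ⟨m, m / r + 1, (hcoeff m).symm⟩
  · rintro ⟨t, k, rfl⟩
    obtain ⟨n, hn⟩ := truncConv_mem_range hp hq hμ hν h hrp hrq hr
      (by obtain ⟨m, -, hm⟩ := hzero; exact ⟨m, by rw [← hcoeff, hm]⟩) t k
    by_cases hle : n ≤ (p - 1) * (q - 1) * (r - 1)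
    · exact ⟨n, hle, by rw [hcoeff, hn]⟩
    · have : Q.coeff n = 0 := coeff_eq_zero_of_natDegree_lt
        ((natDegree_le_of_ternaryId (by omega) (by omega) (by omega) hQ).trans_lt (by omega))
      rw [← hn, ← hcoeff, this]
      exact hzero

/-- If `r, s > max(p,q)` and `r ≡ -s (mod pq)`, then `𝒜(p,q,r) = -𝒜(p,q,s)`. -/
theorem stmt_6 (p q r s : ℕ) (hp : 3 ≤ p) (hq : 3 ≤ q) (hr3 : 3 ≤ r) (hs3 : 3 ≤ s)
    (hpq : Nat.Coprime p q) (hrc : Nat.Coprime r (p * q)) (hsc : Nat.Coprime s (p * q))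
    (hrmax : max p q < r) (hsmax : max p q < s)
    (hmod : (r : ℤ) ≡ -(s : ℤ) [ZMOD ((p : ℤ) * q)])
    (Qr Qs : Polynomial ℤ) (hQr : ternaryId p q r Qr) (hQs : ternaryId p q s Qs) :
    {a : ℤ | ∃ m ≤ (p - 1) * (q - 1) * (r - 1), Qr.coeff m = a} =
      {a : ℤ | ∃ m ≤ (p - 1) * (q - 1) * (s - 1), Qs.coeff m = -a} := by
  obtain ⟨μ, ν, hμ, hν, h⟩ := exists_mul_add_mul_eq hp hq hpq
  have hmod' : (r : ℤ) ≡ -(s : ℤ) [ZMOD (p * q : ℕ)] := by exact_mod_cast hmod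
  have hne : p ≠ q := by
    rintro rfl
    simp at hpq
    omega
  ext a
  rw [Set.mem_ofPred_eq, Set.mem_ofPred_eq,
    setOf_coeff_eq_range_truncConv hp hq hne hμ hν h (by omega) (by omega) hrc hQr,
    setOf_coeff_eq_range_truncConv hp hq hne hμ hν h (by omega) (by omega) hsc hQs]
  constructor
  · rintro ⟨t, k, rfl⟩
    refine ⟨p + q - 1 - t, k, ?_⟩
    rw [truncConv_neg hp hq μ ν hmod']
    congr 2
    ring
  · rintro ⟨t, k, hk⟩
    refine ⟨p + q - 1 - t, k, ?_⟩
    rw [truncConv_neg hp hq μ ν hmod'] at hk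
    exact neg_injective hk
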